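/- For an arbitrary permutation σ of {0,...,m−1}, the trace of the composition of the permutation action of σ with h^{⊗m} on V^{⊗m} equals the product over the cycles of σ of the traces of the corresponding powers of h; explicitly, Tr(σ ∘ h^{⊗m}) = (Tr h)^{m − |supp σ|} · ∏_{d ∈ cycleType(σ)} Tr(h^d), where supp σ is the set of non-fixed points of σ and cycleType(σ) is the multiset of lengths (each ≥ 2) of the nontrivial cycles of σ. In the language of the paper: for a permutation g with r cycles of lengths m_1,...,m_r, Tr(g | V^{⊗m}) = Ψ^{m_1}(V) ⊗ ... ⊗ Ψ^{m_r}(V). -/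

import Mathlib

/-- cyclic sum over index assignments -/
def TT {K κ α : Type*} [Field K] [Fintype κ] [Fintype α] [DecidableEq α]
    (A : Matrix κ κ K) (σ : Equiv.Perm α) : K :=
  ∑ p : α → κ, ∏ i, A (p i) (p (σ i))

theorem TT_path {K κ : Type*} [Field K] [Fintype κ] [DecidableEq κ]
    (A : Matrix κ κ K) (n : ℕ) : ∀ (a b : κ), (A ^ (n + 1)) a b =
      ∑ p : Fin n → κ, ∏ i : Fin (n + 1),
        A ((Fin.cons a p : Fin (n + 1) → κ) i) ((Fin.snoc p b : Fin (n + 1) → κ) i) := by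
  induction n with
  | zero => intro a b; simp [Fin.snoc]
  | succ n ih =>
    intro a b
    rw [pow_succ', Matrix.mul_apply, ← (Fin.consEquiv (fun _ : Fin (n + 1) => κ)).sum_comp,
      Fintype.sum_prod_type]
    refine Finset.sum_congr rfl fun c _ => ?_
    rw [ih, Finset.mul_sum]
    refine Finset.sum_congr rfl fun p _ => ?_
    rw [Fin.prod_univ_succ (n := n + 1)]
    have e : (Fin.snoc ((Fin.consEquiv fun _ : Fin (n + 1) => κ) (c, p)) b : Fin (n + 2) → κ) =
        Fin.cons c (Fin.snoc p b : Fin (n + 1) → κ) :=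
      (Fin.cons_snoc_eq_snoc_cons c p b).symm
    rw [e]
    simp only [Fin.consEquiv_apply, Fin.cons_zero, Fin.cons_succ]

theorem TT_finRotate {K κ : Type*} [Field K] [Fintype κ] [DecidableEq κ]
    (A : Matrix κ κ K) (n : ℕ) : TT A (finRotate (n + 1)) = (A ^ (n + 1)).trace := by
  unfold TT
  rw [Matrix.trace, ← (Fin.consEquiv (fun _ : Fin (n + 1) => κ)).sum_comp, Fintype.sum_prod_type]
  refine Finset.sum_congr rfl fun a _ => ?_
  rw [Matrix.diag_apply, TT_path]
  refine Finset.sum_congr rfl fun p _ => Finset.prod_congr rfl fun i _ => ?_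
  simp only [Fin.consEquiv_apply]
  congr 1
  refine Fin.lastCases ?_ (fun j => ?_) i
  · simp
  · rw [Fin.snoc_castSucc, finRotate_apply, Fin.coeSucc_eq_succ, Fin.cons_succ]

theorem TT_conj {K κ α β : Type*} [Field K] [Fintype κ] [Fintype α] [DecidableEq α]
    [Fintype β] [DecidableEq β]
    (A : Matrix κ κ K) (e : α ≃ β) (σ : Equiv.Perm α) (τ : Equiv.Perm β)
    (he : ∀ x, e (σ x) = τ (e x)) : TT A τ = TT A σ := by
  unfold TT
  refine Fintype.sum_equiv (e.symm.arrowCongr (Equiv.refl κ)) _ _ fun p => ?_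
  rw [← e.prod_comp]
  refine Finset.prod_congr rfl fun i _ => ?_
  simp [he]

theorem TT_cycle {K κ α : Type*} [Field K] [Fintype κ] [DecidableEq κ] [Fintype α] [DecidableEq α]
    (A : Matrix κ κ K) (σ : Equiv.Perm α) (h : σ.cycleType = {Fintype.card α})
    (h2 : 2 ≤ Fintype.card α) :
    TT A σ = (A ^ (Fintype.card α)).trace := by
  obtain ⟨n, hn⟩ := Nat.exists_eq_add_of_le' h2
  have e : Fin (n + 2) ≃ α := (finCongr hn.symm).trans (Fintype.equivFin α).symm
  set τ : Equiv.Perm α := e.permCongr (finRotate (n + 2)) with hτ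
  have h1 : τ.cycleType = {n + 2} := by
    have := cycleType_finRotate (n := n)
    rw [← this, hτ]
    have := Equiv.Perm.cycleType_extendDomain (p := fun _ : α => True)
      (e.trans (Equiv.Set.univ α).symm) (g := finRotate (n + 2))
    rw [← this]
    congr 1
  have h3 : IsConj τ σ := by
    rw [Equiv.Perm.isConj_iff_cycleType_eq, h1, h, hn]
  obtain ⟨g, hg⟩ := isConj_iff.1 h3
  rw [hn, ← TT_finRotate, TT_conj A (e.trans g)]
  intro x
  rw [← hg]
  simp [hτ, Equiv.permCongr_apply]

theorem TT_split {K κ α : Type*} [Field K] [Fintype κ] [Fintype α] [DecidableEq α]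
    (A : Matrix κ κ K) (P : α → Prop) [DecidablePred P] (σ : Equiv.Perm {x // P x})
    (τ : Equiv.Perm {x // ¬ P x}) :
    TT A (σ.subtypeCongr τ) = TT A σ * TT A τ := by
  rw [TT_conj A (Equiv.sumCompl P) (Equiv.sumCongr σ τ) (σ.subtypeCongr τ)]
  · unfold TT
    rw [← (Equiv.sumArrowEquivProdArrow _ _ κ).symm.sum_comp, Fintype.sum_prod_type,
      Finset.sum_mul_sum]
    refine Finset.sum_congr rfl fun p _ => Finset.sum_congr rfl fun q _ => ?_
    simp [Fintype.prod_sum_type, Equiv.sumArrowEquivProdArrow]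
  · rintro (x | x) <;> simp [Equiv.Perm.subtypeCongr]

theorem TT_main {K κ : Type*} [Field K] [Fintype κ] [DecidableEq κ]
    (A : Matrix κ κ K) (n : ℕ) : ∀ {α : Type} [Fintype α] [DecidableEq α]
    (_ : Fintype.card α = n) (σ : Equiv.Perm α),
    TT A σ = A.trace ^ (n - σ.support.card) *
      (σ.cycleType.map fun d => (A ^ d).trace).prod := by
  induction n using Nat.strong_induction_on with
  | _ n ih =>
  intro α _ _ hα σ
  by_cases h1 : σ = 1
  · subst h1
    simp only [TT, Equiv.Perm.one_apply, Equiv.Perm.support_one, Finset.card_empty, Nat.sub_zero,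
      Equiv.Perm.cycleType_one, Multiset.map_zero, Multiset.prod_zero, mul_one, ← hα]
    rw [Matrix.trace, ← Finset.card_univ, ← Finset.prod_const, Finset.prod_univ_sum]
    simp
  · obtain ⟨c, hc⟩ := Finset.nonempty_iff_ne_empty.2
      (mt Equiv.Perm.cycleFactorsFinset_eq_empty_iff.1 h1)
    have hcc := (Equiv.Perm.mem_cycleFactorsFinset_iff.1 hc).1
    have hcs := (Equiv.Perm.mem_cycleFactorsFinset_iff.1 hc).2
    have hP : ∀ x, σ x ∈ c.support ↔ x ∈ c.support := fun x =>
      Equiv.Perm.mem_cycleFactorsFinset_support hc x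
    obtain ⟨P, hPd⟩ : ∃ P : α → Prop, ∀ x, P x ↔ x ∈ c.support := ⟨_, fun _ => Iff.rfl⟩
    letI : DecidablePred P := Classical.decPred P
    replace hP : ∀ x, P (σ x) ↔ P x := fun x => by rw [hPd, hPd, hP]
    let s := σ.subtypePerm (p := P) hP
    let t := σ.subtypePerm (p := fun x => ¬ P x) (fun x => not_congr (hP x))
    have hst : s.subtypeCongr t = σ := by
      ext x
      by_cases hx : P x
      · rw [Equiv.Perm.subtypeCongr.left_apply _ _ hx]; rfl
      · rw [Equiv.Perm.subtypeCongr.right_apply _ _ hx]; rfl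
    have hs : Equiv.Perm.ofSubtype s = c := by
      ext x
      by_cases hx : P x
      · rw [Equiv.Perm.ofSubtype_apply_of_mem _ hx]; exact (hcs x ((hPd x).1 hx)).symm
      · rw [Equiv.Perm.ofSubtype_apply_of_not_mem _ hx]
        exact (Equiv.Perm.notMem_support.1 (mt (hPd x).2 hx)).symm
    have hmul : σ = c * Equiv.Perm.ofSubtype t := by
      rw [← hs]
      ext x
      rw [Equiv.Perm.mul_apply]
      by_cases hx : P x
      · rw [Equiv.Perm.ofSubtype_apply_of_not_mem t (not_not.2 hx),
          Equiv.Perm.ofSubtype_apply_of_mem _ hx]; rfl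
      · rw [Equiv.Perm.ofSubtype_apply_of_mem t hx, Equiv.Perm.ofSubtype_apply_of_not_mem]
        · rfl
        · exact (not_congr (hP x)).2 hx
    have hdis : c.Disjoint (Equiv.Perm.ofSubtype t) := by
      intro x
      by_cases hx : P x
      · right; exact Equiv.Perm.ofSubtype_apply_of_not_mem t (not_not.2 hx)
      · left; exact Equiv.Perm.notMem_support.1 (mt (hPd x).2 hx)
    have hct : σ.cycleType = {c.support.card} + t.cycleType := by
      conv_lhs => rw [hmul]
      rw [hdis.cycleType_mul, hcc.cycleType, Equiv.Perm.cycleType_ofSubtype]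
    have hcardP : Fintype.card {x // P x} = c.support.card := by
      rw [Fintype.card_subtype]; congr 1; ext x; simp [hPd]
    have hsct : s.cycleType = {Fintype.card {x // P x}} := by
      rw [hcardP, ← hcc.cycleType, ← hs, Equiv.Perm.cycleType_ofSubtype]
    have hcard : Fintype.card {x // ¬ P x} = n - c.support.card := by
      rw [Fintype.card_subtype_compl, hα, hcardP]
    have hle : c.support.card ≤ n := hα ▸ Finset.card_le_univ _
    have h2 := hcc.two_le_card_support
    conv_lhs => rw [← hst]
    rw [TT_split, TT_cycle A s hsct (hcardP ▸ h2), hcardP, ih _ (by omega) hcard t, hct]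
    have hsup : σ.support.card = c.support.card + t.support.card := by
      rw [← Equiv.Perm.sum_cycleType, hct, ← Equiv.Perm.sum_cycleType t]; simp
    rw [hsup, Nat.sub_sub, Multiset.map_add, Multiset.prod_add]
    simp only [Multiset.map_singleton, Multiset.prod_singleton]
    ring

/-- For a permutation `σ` of the `m` tensor factors,
`Tr(σ ∘ h^{⊗m}) = (Tr h)^{m − |supp σ|} · ∏_{d ∈ cycleType σ} Tr(h^d)`;
in the language of the paper, for `g` with cycles of lengths `m_1,…,m_r`,
`Tr(g | V^{⊗m}) = Ψ^{m_1}(V) ⊗ ⋯ ⊗ Ψ^{m_r}(V)`. -/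
theorem stmt1 {K V : Type*} [Field K] [AddCommGroup V] [Module K V] [FiniteDimensional K V]
    (m : ℕ) (hm : 1 ≤ m) (h : V →ₗ[K] V) (σ : Equiv.Perm (Fin m)) :
    LinearMap.trace K (PiTensorProduct K fun _ : Fin m => V)
      ((PiTensorProduct.reindex K (fun _ : Fin m => V) σ).toLinearMap ∘ₗ
        PiTensorProduct.map fun _ => h) =
    (LinearMap.trace K V h) ^ (m - σ.support.card) *
      (σ.cycleType.map fun d => LinearMap.trace K V (h ^ d)).prod := by
  classical
  let b := Module.finBasis K V
  set A := LinearMap.toMatrix b b h with hA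
  have htr : ∀ d, LinearMap.trace K V (h ^ d) = (A ^ d).trace := fun d => by
    rw [LinearMap.trace_eq_matrix_trace K b, LinearMap.toMatrix_pow]
  have htr1 : LinearMap.trace K V h = A.trace := LinearMap.trace_eq_matrix_trace K b h
  have := TT_main A m (Fintype.card_fin m) σ⁻¹
  rw [Equiv.Perm.cycleType_inv, Equiv.Perm.support_inv] at this
  simp only [htr, htr1]
  rw [← this, LinearMap.trace_eq_matrix_trace K (Basis.piTensorProduct fun _ : Fin m => b),
    Matrix.trace]
  unfold TT
  refine Finset.sum_congr rfl fun p _ => ?_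
  rw [Matrix.diag_apply, LinearMap.toMatrix_apply, Basis.piTensorProduct_apply]
  rw [LinearMap.comp_apply, PiTensorProduct.map_tprod, LinearEquiv.coe_coe,
    PiTensorProduct.reindex_tprod, Basis.piTensorProduct_repr_tprod_apply]
  refine Finset.prod_congr rfl fun i _ => ?_
  rw [hA, LinearMap.toMatrix_apply]
  rfl
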